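/- Let C be a finite set of p-atoms π(z₁,z₂) where each π is an ICPDL program and z₁,z₂ ∈ Vars(C), such that the graph G_C is a clique and |Vars(C)| ≤ 3. Then: (1) for all distinct x,y ∈ Vars(C) there is an ICPDL program π_{C[x,y]} that is semantically equivalent to the conjunctive program C[x,y] (same semantics in every structure); (2) for every x ∈ Vars(C) there is an ICPDL program π_{C[x,x]} semantically equivalent to C[x,x]. Moreover these ICPDL programs can be computed in polynomial time. -/

import Mathlib

namespace PaperCPDL

/-- Relational structures over a fixed countably infinite signature:
for every arity `n` there are countably many relation names, indexed by `ℕ`. -/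
structure Struct : Type 1 where
  World : Type
  rel : (n : ℕ) → ℕ → (Fin n → World) → Prop

namespace Struct

variable (K : Struct)

/-- Atomic propositions are the unary relation names. -/
def prop (p : ℕ) (w : K.World) : Prop := K.rel 1 p fun _ => w

/-- Atomic programs are the binary relation names. -/
def prog (a : ℕ) (u v : K.World) : Prop :=
  K.rel 2 a fun i => if (i : ℕ) = 0 then u else v

/-- A Kripke structure interprets every relation of arity `> 2` as the empty relation. -/
def IsKripke : Prop := ∀ n, 2 < n → ∀ r (t : Fin n → K.World), ¬ K.rel n r t

/-- Gaifman adjacency: `u` and `v` occur together in a tuple of some relation. -/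
def gadj (u v : K.World) : Prop :=
  ∃ (n r : ℕ) (t : Fin n → K.World), K.rel n r t ∧ (∃ i, t i = u) ∧ ∃ j, t j = v

/-- distance at most 1 in the Gaifman graph. -/
def near (u v : K.World) : Prop := u = v ∨ K.gadj u v

/-- same connected component of the Gaifman graph. -/
def sameComp (u v : K.World) : Prop := Relation.ReflTransGen K.gadj u v

/-- finite degree: every world has finitely many Gaifman-neighbours. -/
def FiniteDegree : Prop := ∀ u, {v | K.gadj u v}.Finite

end Struct

/-- r-atoms `R(x₁,…,xₙ)`: a relation name with its argument variables. -/
structure RAtom where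
  name : ℕ
  args : List ℕ

mutual
  /-- Formulas of (U)CPDL⁺ (together with `loop` and program intersection,
  used to carve out the various fragments). -/
  inductive Fml : Type where
    | prop : ℕ → Fml
    | neg : Fml → Fml
    | and : Fml → Fml → Fml
    | diam : Prog → Fml
    | loop : Prog → Fml
  /-- Programs. -/
  inductive Prog : Type where
    | eps : Prog
    | atom : ℕ → Prog
    | conv : ℕ → Prog
    | union : Prog → Prog → Prog
    | comp : Prog → Prog → Prog
    | star : Prog → Prog
    | test : Fml → Prog
    | inter : Prog → Prog → Prog
    | univ : Prog
    | cq : PList → List RAtom → ℕ → ℕ → Prog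
  /-- Finite lists of p-atoms `π(x,y)`. -/
  inductive PList : Type where
    | nil : PList
    | cons : Prog → ℕ → ℕ → PList → PList
end

/-- satisfaction of an r-atom under an assignment. -/
def Struct.ratomSat (K : Struct) (f : ℕ → K.World) (r : RAtom) : Prop :=
  K.rel r.args.length r.name fun i => f (r.args.get i)

mutual
  /-- semantics of formulas. -/
  def evalF (K : Struct) : Fml → K.World → Prop
    | .prop p, w => K.prop p w
    | .neg φ, w => ¬ evalF K φ w
    | .and φ ψ, w => evalF K φ w ∧ evalF K ψ w
    | .diam π, w => ∃ v, evalP K π w v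
    | .loop π, w => evalP K π w w
  /-- semantics of programs. -/
  def evalP (K : Struct) : Prog → K.World → K.World → Prop
    | .eps, u, v => u = v
    | .atom a, u, v => K.prog a u v
    | .conv a, u, v => K.prog a v u
    | .union π₁ π₂, u, v => evalP K π₁ u v ∨ evalP K π₂ u v
    | .comp π₁ π₂, u, v => ∃ w, evalP K π₁ u w ∧ evalP K π₂ w v
    | .star π, u, v => Relation.ReflTransGen (fun a b => evalP K π a b) u v
    | .test φ, u, v => u = v ∧ evalF K φ u
    | .inter π₁ π₂, u, v => evalP K π₁ u v ∧ evalP K π₂ u v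
    | .univ, _, _ => True
    | .cq ps rs xs xt, u, v =>
        ∃ f : ℕ → K.World, f xs = u ∧ f xt = v ∧ evalPL K f ps ∧ ∀ r ∈ rs, K.ratomSat f r
  /-- semantics of a list of p-atoms. -/
  def evalPL (K : Struct) (f : ℕ → K.World) : PList → Prop
    | .nil => True
    | .cons π x y ps => evalP K π (f x) (f y) ∧ evalPL K f ps
end

/-! ## Conjunctive programs: variables, underlying graph, well-formedness -/

/-- variables occurring in a list of p-atoms. -/
def PList.vars : PList → List ℕ
  | .nil => []
  | .cons _ x y ps => x :: y :: ps.vars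

/-- variables of a conjunctive program given by p-atoms `ps` and r-atoms `rs`. -/
def cqVars (ps : PList) (rs : List RAtom) : List ℕ :=
  ps.vars ++ (rs.map RAtom.args).flatten

/-- co-occurrence of two variables in a p-atom of the list. -/
def PList.coOcc (x y : ℕ) : PList → Prop
  | .nil => False
  | .cons _ a b ps => ((x = a ∨ x = b) ∧ (y = a ∨ y = b)) ∨ PList.coOcc x y ps

/-- adjacency in the graph `G_C`: co-occurrence of two variables in some atom. -/
def atomAdj (ps : PList) (rs : List RAtom) (x y : ℕ) : Prop :=
  ps.coOcc x y ∨ ∃ r ∈ rs, x ∈ r.args ∧ y ∈ r.args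

/-- adjacency in the underlying graph of `C[x_s,x_t]`: `G_C` plus the edge `{x_s,x_t}`. -/
def ugAdj (ps : PList) (rs : List RAtom) (xs xt : ℕ) (x y : ℕ) : Prop :=
  atomAdj ps rs x y ∨ (x = xs ∧ y = xt) ∨ (x = xt ∧ y = xs)

/-- base well-formedness of a conjunctive program `C[x_s,x_t]`:
`x_s,x_t ∈ Vars(C)`, every r-atom has arity `> 2`, and `G_C` is connected. -/
def cqWF (ps : PList) (rs : List RAtom) (xs xt : ℕ) : Prop :=
  xs ∈ cqVars ps rs ∧ xt ∈ cqVars ps rs ∧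
  (∀ r ∈ rs, 2 < r.args.length) ∧
  ∀ x ∈ cqVars ps rs, ∀ y ∈ cqVars ps rs, Relation.ReflTransGen (atomAdj ps rs) x y

/-! ## Tree decompositions and tree-width -/

/-- A tree decomposition of the graph with vertex set `V` and adjacency `adj`. -/
structure TreeDecomp {α : Type} (V : Set α) (adj : α → α → Prop) where
  /-- the nodes of the tree -/
  B : Type
  /-- the tree -/
  tree : SimpleGraph B
  isTree : tree.IsTree
  /-- the bags -/
  bag : B → Set α
  cover_vert : ∀ v ∈ V, ∃ b, v ∈ bag b
  cover_edge : ∀ u v, adj u v → ∃ b, u ∈ bag b ∧ v ∈ bag b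
  bags_conn : ∀ (v : α) (b₁ b₂ : B), v ∈ bag b₁ → v ∈ bag b₂ →
      ∃ p : tree.Walk b₁ b₂, ∀ x ∈ p.support, v ∈ bag x

/-- the width of a tree decomposition is at most `k`. -/
def TreeDecomp.WidthLE {α : Type} {V : Set α} {adj : α → α → Prop}
    (td : TreeDecomp V adj) (k : ℕ) : Prop :=
  ∀ b, (td.bag b).Finite ∧ (td.bag b).ncard ≤ k + 1

/-- the graph `(V, adj)` has tree-width at most `k`. -/
def TreewidthLE {α : Type} (V : Set α) (adj : α → α → Prop) (k : ℕ) : Prop :=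
  ∃ td : TreeDecomp V adj, td.WidthLE k

/-- the Gaifman graph of the structure `K` has tree-width at most `k`. -/
def Struct.twLE (K : Struct) (k : ℕ) : Prop :=
  TreewidthLE (Set.univ : Set K.World) K.gadj k

/-- A good tree decomposition: along every tree edge one bag contains the other,
and the tree is binary (it has a root of degree `≤ 2`, all other nodes have degree `≤ 3`). -/
def TreeDecomp.Good {α : Type} {V : Set α} {adj : α → α → Prop} (td : TreeDecomp V adj) : Prop :=
  (∀ b b', td.tree.Adj b b' → td.bag b ⊆ td.bag b' ∨ td.bag b' ⊆ td.bag b) ∧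
  ∃ r : td.B, ∀ b, {b' | td.tree.Adj b b'}.Finite ∧
    ((b = r → {b' | td.tree.Adj b b'}.ncard ≤ 2) ∧ (b ≠ r → {b' | td.tree.Adj b b'}.ncard ≤ 3))

/-! ## Fragments -/

/-- all p-atoms of the list are of the form `π(x,x)` for the fixed variable `x`. -/
def PList.allOn (x : ℕ) : PList → Prop
  | .nil => True
  | .cons _ a b ps => a = x ∧ b = x ∧ PList.allOn x ps

/-- A fragment specification: which of `loop`, `∩`, `U` are allowed, and which
shapes of conjunctive programs are allowed. -/
structure Frag where
  loopOK : Prop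
  interOK : Prop
  univOK : Prop
  cqOK : PList → List RAtom → ℕ → ℕ → Prop

mutual
  /-- the formula belongs to the fragment `F`. -/
  def Fml.In : Frag → Fml → Prop
    | _, .prop _ => True
    | F, .neg φ => Fml.In F φ
    | F, .and φ ψ => Fml.In F φ ∧ Fml.In F ψ
    | F, .diam π => Prog.In F π
    | F, .loop π => F.loopOK ∧ Prog.In F π
  /-- the program belongs to the fragment `F`. -/
  def Prog.In : Frag → Prog → Prop
    | _, .eps => True
    | _, .atom _ => True
    | _, .conv _ => True
    | F, .union π₁ π₂ => Prog.In F π₁ ∧ Prog.In F π₂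
    | F, .comp π₁ π₂ => Prog.In F π₁ ∧ Prog.In F π₂
    | F, .star π => Prog.In F π
    | F, .test φ => Fml.In F φ
    | F, .inter π₁ π₂ => F.interOK ∧ Prog.In F π₁ ∧ Prog.In F π₂
    | F, .univ => F.univOK
    | F, .cq ps rs xs xt => F.cqOK ps rs xs xt ∧ cqWF ps rs xs xt ∧ PList.In F ps
  /-- all programs of the list belong to the fragment `F`. -/
  def PList.In : Frag → PList → Prop
    | _, .nil => True
    | F, .cons π _ _ ps => Prog.In F π ∧ PList.In F ps
end

/-- CPDL: PDL with converse. -/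
def Frag.cpdl : Frag := ⟨False, False, False, fun _ _ _ _ => False⟩
/-- ICPDL: CPDL with program intersection. -/
def Frag.icpdl : Frag := ⟨False, True, False, fun _ _ _ _ => False⟩
/-- loop-CPDL: CPDL with `loop(π)` formulas. -/
def Frag.loopCpdl : Frag := ⟨True, False, False, fun _ _ _ _ => False⟩
/-- CPDL⁺: CPDL with conjunctive programs. -/
def Frag.cpdlPlus : Frag := ⟨False, False, False, fun _ _ _ _ => True⟩
/-- UCPDL⁺: CPDL⁺ with the universal program. -/
def Frag.ucpdlPlus : Frag := ⟨False, False, True, fun _ _ _ _ => True⟩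
/-- CPDL⁺(TW_k): conjunctive programs with underlying graph of tree-width `≤ k`. -/
def Frag.tw (k : ℕ) : Frag :=
  ⟨False, False, False, fun ps rs xs xt =>
    TreewidthLE {x | x ∈ cqVars ps rs} (ugAdj ps rs xs xt) k⟩
/-- UCPDL⁺(TW_k). -/
def Frag.utw (k : ℕ) : Frag :=
  ⟨False, False, True, fun ps rs xs xt =>
    TreewidthLE {x | x ∈ cqVars ps rs} (ugAdj ps rs xs xt) k⟩
/-- CPDL⁺(𝒢↺): the only conjunctive programs are `C[x,x]` where all atoms
are p-atoms of the form `π(x,x)`. -/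
def Frag.gloop : Frag :=
  ⟨False, False, False, fun ps rs xs xt => xt = xs ∧ rs = [] ∧ PList.allOn xs ps⟩
/-- ICPDL⁺(TW₂): CPDL⁺(TW₂) together with program intersection. -/
def Frag.icpdlPlusTw2 : Frag :=
  ⟨False, True, False, fun ps rs xs xt =>
    TreewidthLE {x | x ∈ cqVars ps rs} (ugAdj ps rs xs xt) 2⟩

mutual
  /-- positive formulas: no occurrence of negation. -/
  def Fml.Positive : Fml → Prop
    | .prop _ => True
    | .neg _ => False
    | .and φ ψ => Fml.Positive φ ∧ Fml.Positive ψ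
    | .diam π => Prog.Positive π
    | .loop π => Prog.Positive π
  /-- positive programs. -/
  def Prog.Positive : Prog → Prop
    | .eps => True
    | .atom _ => True
    | .conv _ => True
    | .union π₁ π₂ => Prog.Positive π₁ ∧ Prog.Positive π₂
    | .comp π₁ π₂ => Prog.Positive π₁ ∧ Prog.Positive π₂
    | .star π => Prog.Positive π
    | .test φ => Fml.Positive φ
    | .inter π₁ π₂ => Prog.Positive π₁ ∧ Prog.Positive π₂
    | .univ => True
    | .cq ps _ _ _ => PList.Positive ps
  /-- positive p-atom lists. -/
  def PList.Positive : PList → Prop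
    | .nil => True
    | .cons π _ _ ps => Prog.Positive π ∧ PList.Positive ps
end

/-! ## Sizes, conjunctive width, intersection width -/

/-- sum of the arities of a list of r-atoms. -/
def ratomSize (rs : List RAtom) : ℕ := (rs.map fun r => r.args.length).sum

mutual
  /-- size of a formula. -/
  def Fml.fsize : Fml → ℕ
    | .prop _ => 1
    | .neg φ => 1 + Fml.fsize φ
    | .and φ ψ => Fml.fsize φ + Fml.fsize ψ
    | .diam π => 1 + Prog.psize π
    | .loop π => 1 + Prog.psize π
  /-- size of a program. -/
  def Prog.psize : Prog → ℕ
    | .eps => 1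
    | .atom _ => 1
    | .conv _ => 1
    | .union π₁ π₂ => Prog.psize π₁ + Prog.psize π₂
    | .comp π₁ π₂ => Prog.psize π₁ + Prog.psize π₂
    | .star π => 1 + Prog.psize π
    | .test φ => 1 + Fml.fsize φ
    | .inter π₁ π₂ => Prog.psize π₁ + Prog.psize π₂
    | .univ => 1
    | .cq ps rs _ _ => ratomSize rs + PList.plsize ps
  /-- size of a p-atom list: `Σ (1 + |π|)`. -/
  def PList.plsize : PList → ℕ
    | .nil => 0
    | .cons π _ _ ps => 1 + Prog.psize π + PList.plsize ps
end

mutual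
  /-- conjunctive width of a program. -/
  def Prog.cw : Prog → ℕ
    | .eps => 1
    | .atom _ => 1
    | .conv _ => 1
    | .union π₁ π₂ => max (Prog.cw π₁) (Prog.cw π₂)
    | .comp π₁ π₂ => max (Prog.cw π₁) (Prog.cw π₂)
    | .star π => Prog.cw π
    | .test _ => 1
    | .inter π₁ π₂ => Prog.cw π₁ + Prog.cw π₂
    | .univ => 1
    | .cq ps rs _ _ => ratomSize rs + PList.cwSum ps
  /-- sum of the conjunctive widths of the programs of a p-atom list. -/
  def PList.cwSum : PList → ℕ
    | .nil => 0
    | .cons π _ _ ps => Prog.cw π + PList.cwSum ps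
end

mutual
  /-- conjunctive width of a formula: max of `Prog.cw` over all programs therein. -/
  def Fml.cwE : Fml → ℕ
    | .prop _ => 1
    | .neg φ => Fml.cwE φ
    | .and φ ψ => max (Fml.cwE φ) (Fml.cwE ψ)
    | .diam π => Prog.cwE π
    | .loop π => Prog.cwE π
  /-- conjunctive width of an expression which is a program. -/
  def Prog.cwE : Prog → ℕ
    | .eps => 1
    | .atom _ => 1
    | .conv _ => 1
    | .union π₁ π₂ => max (Prog.cwE π₁) (Prog.cwE π₂)
    | .comp π₁ π₂ => max (Prog.cwE π₁) (Prog.cwE π₂)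
    | .star π => Prog.cwE π
    | .test φ => Fml.cwE φ
    | .inter π₁ π₂ => max (Prog.cw (.inter π₁ π₂)) (max (Prog.cwE π₁) (Prog.cwE π₂))
    | .univ => 1
    | .cq ps rs xs xt => max (Prog.cw (.cq ps rs xs xt)) (PList.cwEMax ps)
  /-- max conjunctive width over a p-atom list. -/
  def PList.cwEMax : PList → ℕ
    | .nil => 1
    | .cons π _ _ ps => max (Prog.cwE π) (PList.cwEMax ps)
end

mutual
  /-- intersection width of an (I)CPDL program. -/
  def Prog.iw : Prog → ℕ
    | .eps => 1
    | .atom _ => 1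
    | .conv _ => 1
    | .union π₁ π₂ => max (Prog.iw π₁) (Prog.iw π₂)
    | .comp π₁ π₂ => max (Prog.iw π₁) (Prog.iw π₂)
    | .star π => Prog.iw π
    | .test _ => 1
    | .inter π₁ π₂ => Prog.iw π₁ + Prog.iw π₂
    | .univ => 1
    | .cq _ _ _ _ => 1
  /-- max intersection width over a p-atom list (unused on ICPDL). -/
  def PList.iwMax : PList → ℕ
    | .nil => 1
    | .cons π _ _ ps => max (Prog.iwE π) (PList.iwMax ps)
  /-- intersection width of an expression which is a program. -/
  def Prog.iwE : Prog → ℕ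
    | .eps => 1
    | .atom _ => 1
    | .conv _ => 1
    | .union π₁ π₂ => max (Prog.iwE π₁) (Prog.iwE π₂)
    | .comp π₁ π₂ => max (Prog.iwE π₁) (Prog.iwE π₂)
    | .star π => Prog.iwE π
    | .test φ => Fml.iwE φ
    | .inter π₁ π₂ => max (Prog.iw (.inter π₁ π₂)) (max (Prog.iwE π₁) (Prog.iwE π₂))
    | .univ => 1
    | .cq ps _ _ _ => PList.iwMax ps
  /-- intersection width of a formula. -/
  def Fml.iwE : Fml → ℕ
    | .prop _ => 1
    | .neg φ => Fml.iwE φ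
    | .and φ ψ => max (Fml.iwE φ) (Fml.iwE ψ)
    | .diam π => Prog.iwE π
    | .loop π => Prog.iwE π
end

/-! ## Converse of programs -/

/-- The converse of a program. -/
def Prog.rev : Prog → Prog
  | .eps => .eps
  | .atom a => .conv a
  | .conv a => .atom a
  | .union π₁ π₂ => .union (Prog.rev π₁) (Prog.rev π₂)
  | .comp π₁ π₂ => .comp (Prog.rev π₂) (Prog.rev π₁)
  | .star π => .star (Prog.rev π)
  | .test φ => .test φ
  | .inter π₁ π₂ => .inter (Prog.rev π₁) (Prog.rev π₂)
  | .univ => .univ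
  | .cq ps rs xs xt => .cq ps rs xt xs

theorem evalP_rev (K : Struct) :
    ∀ (π : Prog) (u v : K.World), evalP K π.rev u v ↔ evalP K π v u
  | .eps, u, v => by simp [Prog.rev, evalP, eq_comm]
  | .atom a, u, v => by simp [Prog.rev, evalP]
  | .conv a, u, v => by simp [Prog.rev, evalP]
  | .union π₁ π₂, u, v => by
      simp [Prog.rev, evalP, evalP_rev K π₁, evalP_rev K π₂]
  | .comp π₁ π₂, u, v => by
      simp [Prog.rev, evalP, evalP_rev K π₁, evalP_rev K π₂, and_comm]
  | .star π, u, v => by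
      simp only [Prog.rev, evalP, evalP_rev K π]
      exact Relation.reflTransGen_swap
  | .test φ, u, v => by
      simp only [Prog.rev, evalP]
      constructor <;> rintro ⟨rfl, h⟩ <;> exact ⟨rfl, h⟩
  | .inter π₁ π₂, u, v => by
      simp [Prog.rev, evalP, evalP_rev K π₁, evalP_rev K π₂]
  | .univ, u, v => by simp [Prog.rev, evalP]
  | .cq ps rs xs xt, u, v => by
      simp only [Prog.rev, evalP]
      constructor <;> rintro ⟨f, h₁, h₂, h⟩ <;> exact ⟨f, h₂, h₁, h⟩

theorem Prog.psize_rev : ∀ π : Prog, π.rev.psize = π.psize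
  | .eps => rfl
  | .atom _ => by simp [Prog.rev, Prog.psize]
  | .conv _ => by simp [Prog.rev, Prog.psize]
  | .union π₁ π₂ => by
      simp [Prog.rev, Prog.psize, Prog.psize_rev π₁, Prog.psize_rev π₂]
  | .comp π₁ π₂ => by
      simp [Prog.rev, Prog.psize, Prog.psize_rev π₁, Prog.psize_rev π₂, add_comm]
  | .star π => by simp [Prog.rev, Prog.psize, Prog.psize_rev π]
  | .test _ => rfl
  | .inter π₁ π₂ => by
      simp [Prog.rev, Prog.psize, Prog.psize_rev π₁, Prog.psize_rev π₂]
  | .univ => rfl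
  | .cq _ _ _ _ => by simp [Prog.rev, Prog.psize]

theorem Prog.rev_in_icpdl :
    ∀ π : Prog, Prog.In Frag.icpdl π → Prog.In Frag.icpdl π.rev
  | .eps, h => h
  | .atom _, _ => by simp [Prog.rev, Prog.In]
  | .conv _, _ => by simp [Prog.rev, Prog.In]
  | .union π₁ π₂, h => by
      simp only [Prog.rev, Prog.In] at h ⊢
      exact ⟨Prog.rev_in_icpdl π₁ h.1, Prog.rev_in_icpdl π₂ h.2⟩
  | .comp π₁ π₂, h => by
      simp only [Prog.rev, Prog.In] at h ⊢
      exact ⟨Prog.rev_in_icpdl π₂ h.2, Prog.rev_in_icpdl π₁ h.1⟩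
  | .star π, h => by
      simp only [Prog.rev, Prog.In] at h ⊢
      exact Prog.rev_in_icpdl π h
  | .test _, h => h
  | .inter π₁ π₂, h => by
      simp only [Prog.rev, Prog.In] at h ⊢
      exact ⟨h.1, Prog.rev_in_icpdl π₁ h.2.1, Prog.rev_in_icpdl π₂ h.2.2⟩
  | .univ, h => h
  | .cq _ _ _ _, h => by simp [Prog.In, Frag.icpdl] at h

/-! ## Collecting the atoms between two variables -/

/-- The programs of the atoms between `a` and `b`, oriented from `a` to `b`. -/
def PList.between (a b : ℕ) : PList → List Prog
  | .nil => []
  | .cons π s t ps =>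
      if s = a ∧ t = b then π :: ps.between a b
      else if s = b ∧ t = a then π.rev :: ps.between a b
      else ps.between a b

theorem PList.in_icpdl_of_mem_between (a b : ℕ) :
    ∀ ps : PList, PList.In Frag.icpdl ps → ∀ π ∈ ps.between a b, Prog.In Frag.icpdl π
  | .nil, _ => by simp [PList.between]
  | .cons π s t ps, h => by
      simp only [PList.In] at h
      have ih := PList.in_icpdl_of_mem_between a b ps h.2
      have hr := Prog.rev_in_icpdl π h.1
      unfold PList.between
      split_ifs <;> simp_all

theorem PList.sum_psize_between_le (a b : ℕ) :
    ∀ ps : PList, ((ps.between a b).map Prog.psize).sum ≤ ps.plsize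
  | .nil => by simp [PList.between]
  | .cons π s t ps => by
      have ih := PList.sum_psize_between_le a b ps
      unfold PList.between
      split_ifs <;> simp [PList.plsize, Prog.psize_rev] <;> omega

theorem PList.between_ne_nil {a b : ℕ} (hab : a ≠ b) :
    ∀ ps : PList, ps.coOcc a b → ps.between a b ≠ []
  | .nil, h => by simp [PList.coOcc] at h
  | .cons π s t ps, h => by
      simp only [PList.coOcc] at h
      unfold PList.between
      split_ifs with h₁ h₂
      · simp
      · simp
      · refine PList.between_ne_nil hab ps (h.resolve_left ?_)
        rintro ⟨h | h, h' | h'⟩ <;> grind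

theorem evalPL_between {K : Struct} {f : ℕ → K.World} (a b : ℕ) :
    ∀ ps : PList, evalPL K f ps → ∀ π ∈ ps.between a b, evalP K π (f a) (f b)
  | .nil, _ => by simp [PList.between]
  | .cons π s t ps, h => by
      simp only [evalPL] at h
      have ih := evalPL_between a b ps h.2
      have h₁ := h.1
      unfold PList.between
      split_ifs with hs hs
      · obtain ⟨rfl, rfl⟩ := hs
        simpa using ⟨h₁, ih⟩
      · obtain ⟨rfl, rfl⟩ := hs
        simpa [evalP_rev] using ⟨h₁, ih⟩
      · exact ih

theorem evalP_between_symm {K : Struct} {f : ℕ → K.World} (a b : ℕ) :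
    ∀ ps : PList, (∀ π ∈ ps.between a b, evalP K π (f a) (f b)) →
      ∀ π ∈ ps.between b a, evalP K π (f b) (f a)
  | .nil, _ => by simp [PList.between]
  | .cons π s t ps, h => by
      have ih := evalP_between_symm (f := f) a b ps
      by_cases hab : a = b
      · subst hab
        exact h
      unfold PList.between at h ⊢
      split_ifs at h ⊢ with h₁ h₂ h₂ <;> try exact ih h
      · exact absurd (h₂.1.symm.trans h₁.1) hab
      · obtain ⟨rfl, rfl⟩ := h₁
        simp only [List.forall_mem_cons, evalP_rev] at h ⊢
        exact ⟨h.1, ih h.2⟩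
      · obtain ⟨rfl, rfl⟩ := h₂
        simp only [List.forall_mem_cons, evalP_rev] at h ⊢
        exact ⟨h.1, ih h.2⟩

theorem evalPL_of_between {K : Struct} {f : ℕ → K.World} :
    ∀ ps : PList, (∀ a ∈ ps.vars, ∀ b ∈ ps.vars,
      ∀ π ∈ ps.between a b, evalP K π (f a) (f b)) → evalPL K f ps
  | .nil, _ => by simp [evalPL]
  | .cons π s t ps, h => by
      refine ⟨h s (by simp [PList.vars]) t (by simp [PList.vars]) π
        (by simp [PList.between]), evalPL_of_between ps fun a ha b hb ρ hρ => ?_⟩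
      refine h a (by simp [PList.vars, ha]) b (by simp [PList.vars, hb]) ρ ?_
      unfold PList.between
      split_ifs <;> simp [hρ]

/-! ## Intersections of lists of programs -/

/-- The intersection of `π` and all programs of a list. -/
def Prog.interFrom (π : Prog) (l : List Prog) : Prog := l.foldr .inter π

theorem evalP_interFrom {K : Struct} (π : Prog) (l : List Prog) (u v : K.World) :
    evalP K (π.interFrom l) u v ↔ evalP K π u v ∧ ∀ ρ ∈ l, evalP K ρ u v := by
  induction l with
  | nil => simp [Prog.interFrom]
  | cons ρ l ih =>
    simp only [Prog.interFrom, List.foldr_cons, evalP, List.forall_mem_cons] at ih ⊢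
    rw [ih]
    tauto

theorem Prog.psize_interFrom (π : Prog) (l : List Prog) :
    (π.interFrom l).psize = π.psize + (l.map Prog.psize).sum := by
  induction l with
  | nil => simp [Prog.interFrom]
  | cons ρ l ih =>
    simp only [Prog.interFrom, List.foldr_cons, Prog.psize, List.map_cons, List.sum_cons] at ih ⊢
    omega

theorem Prog.interFrom_in_icpdl {π : Prog} {l : List Prog} (hπ : Prog.In Frag.icpdl π)
    (hl : ∀ ρ ∈ l, Prog.In Frag.icpdl ρ) : Prog.In Frag.icpdl (π.interFrom l) := by
  induction l with
  | nil => exact hπ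
  | cons ρ l ih =>
    simp only [List.forall_mem_cons] at hl
    simp only [Prog.interFrom, List.foldr_cons, Prog.In]
    exact ⟨trivial, hl.1, ih hl.2⟩

/-- All atoms `π(a,a)` hold: a subprogram of `ε`. -/
theorem PList.exists_loop_prog (ps : PList) (hps : PList.In Frag.icpdl ps) (a : ℕ) :
    ∃ π : Prog, Prog.In Frag.icpdl π ∧ π.psize ≤ ps.plsize + 1 ∧
      ∀ (K : Struct) (u v : K.World),
        evalP K π u v ↔ u = v ∧ ∀ ρ ∈ ps.between a a, evalP K ρ u v := by
  refine ⟨Prog.eps.interFrom (ps.between a a), Prog.interFrom_in_icpdl (by simp [Prog.In])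
    (PList.in_icpdl_of_mem_between a a ps hps), ?_, fun K u v => ?_⟩
  · have := PList.sum_psize_between_le a a ps
    rw [Prog.psize_interFrom]
    simp only [Prog.psize]
    omega
  · rw [evalP_interFrom]
    simp [evalP]

/-- Two distinct co-occurring variables: all atoms between them hold. -/
theorem PList.exists_edge_prog (ps : PList) (hps : PList.In Frag.icpdl ps) {a b : ℕ}
    (hab : a ≠ b) (h : atomAdj ps [] a b) :
    ∃ π : Prog, Prog.In Frag.icpdl π ∧ π.psize ≤ ps.plsize ∧
      ∀ (K : Struct) (u v : K.World),
        evalP K π u v ↔ ∀ ρ ∈ ps.between a b, evalP K ρ u v := by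
  have hne := PList.between_ne_nil hab ps (by simpa [atomAdj] using h)
  have hin := PList.in_icpdl_of_mem_between a b ps hps
  have hsz := PList.sum_psize_between_le a b ps
  obtain ⟨π, l, hl⟩ := List.exists_cons_of_ne_nil hne
  rw [hl] at hin hsz ⊢
  simp only [List.forall_mem_cons, List.map_cons, List.sum_cons] at hin hsz
  refine ⟨π.interFrom l, Prog.interFrom_in_icpdl hin.1 hin.2, ?_, fun K u v => ?_⟩
  · rwa [Prog.psize_interFrom]
  · simp [evalP_interFrom]

/-- The case of two distinct distinguished variables. -/
theorem exists_icpdl_prog_of_ne (ps : PList) (hps : PList.In Frag.icpdl ps)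
    (hcard : ps.vars.toFinset.card ≤ 3)
    (hclique : ∀ x ∈ ps.vars, ∀ y ∈ ps.vars, x ≠ y → atomAdj ps [] x y)
    {x y : ℕ} (hx : x ∈ ps.vars) (hy : y ∈ ps.vars) (hxy : x ≠ y) :
    ∃ π : Prog, Prog.In Frag.icpdl π ∧
      (∀ (K : Struct) (u v : K.World), evalP K π u v ↔ evalP K (.cq ps [] x y) u v) ∧
      π.psize ≤ 6 * (ps.plsize + 1) := by
  obtain ⟨lx, hlx, slx, elx⟩ := ps.exists_loop_prog hps x
  obtain ⟨ly, hly, sly, ely⟩ := ps.exists_loop_prog hps y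
  obtain ⟨exy, hexy, sexy, eexy⟩ := ps.exists_edge_prog hps hxy (hclique x hx y hy hxy)
  by_cases hz : ∃ z ∈ ps.vars, z ≠ x ∧ z ≠ y
  · obtain ⟨z, hz, hzx, hzy⟩ := hz
    have hvars : ∀ a ∈ ps.vars, a = x ∨ a = y ∨ a = z := by
      intro a ha
      by_contra! hne
      have hsub : ({a, x, y, z} : Finset ℕ) ⊆ ps.vars.toFinset := by
        intro b hb
        simp only [Finset.mem_insert, Finset.mem_singleton] at hb
        rw [List.mem_toFinset]
        rcases hb with rfl | rfl | rfl | rfl <;> assumption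
      have := Finset.card_le_card hsub
      rw [Finset.card_insert_of_notMem (by simp [hne]),
        Finset.card_insert_of_notMem (by simp [hxy, hzx.symm]),
        Finset.card_insert_of_notMem (by simp [hzy.symm])] at this
      simp at this
      omega
    obtain ⟨lz, hlz, slz, elz⟩ := ps.exists_loop_prog hps z
    obtain ⟨exz, hexz, sexz, eexz⟩ :=
      ps.exists_edge_prog hps hzx.symm (hclique x hx z hz hzx.symm)
    obtain ⟨ezy, hezy, sezy, eezy⟩ := ps.exists_edge_prog hps hzy (hclique z hz y hy hzy)
    refine ⟨.comp lx (.comp (.inter exy (.comp exz (.comp lz ezy))) ly), ?_, ?_, ?_⟩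
    · simp only [Prog.In]
      exact ⟨hlx, ⟨trivial, hexy, hexz, hlz, hezy⟩, hly⟩
    · intro K u v
      simp only [evalP, elx, ely, elz, eexy, eexz, eezy]
      constructor
      · rintro ⟨_, ⟨rfl, hxx⟩, v, ⟨hxy', w, hxz', _, ⟨rfl, hzz'⟩, hzy'⟩, rfl, hyy⟩
        obtain ⟨f, rfl, rfl, rfl⟩ : ∃ f : ℕ → K.World, f x = u ∧ f y = v ∧ f z = w :=
          ⟨fun n => if n = x then u else if n = y then v else w,
            by simp, by simp [hxy.symm], by simp [hzx, hzy]⟩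
        refine ⟨f, rfl, rfl, evalPL_of_between ps fun a ha b hb => ?_, by simp⟩
        rcases hvars a ha with rfl | rfl | rfl <;> rcases hvars b hb with rfl | rfl | rfl <;>
          first | assumption | (apply evalP_between_symm; assumption)
      · rintro ⟨f, rfl, rfl, hf, -⟩
        have h := fun a b => evalPL_between (f := f) a b ps hf
        exact ⟨_, ⟨rfl, h x x⟩, _, ⟨h x y, f z, h x z, _, ⟨rfl, h z z⟩, h z y⟩, rfl, h y y⟩
    · simp only [Prog.psize]
      omega
  · push Not at hz
    have hvars : ∀ a ∈ ps.vars, a = x ∨ a = y := fun a ha => or_iff_not_imp_left.2 (hz a ha)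
    refine ⟨.comp lx (.comp exy ly), ?_, ?_, ?_⟩
    · simp only [Prog.In]
      exact ⟨hlx, hexy, hly⟩
    · intro K u v
      simp only [evalP, elx, ely, eexy]
      constructor
      · rintro ⟨_, ⟨rfl, hxx⟩, v, hxy', rfl, hyy⟩
        obtain ⟨f, rfl, rfl⟩ : ∃ f : ℕ → K.World, f x = u ∧ f y = v :=
          ⟨fun n => if n = x then u else v, by simp, by simp [hxy.symm]⟩
        refine ⟨f, rfl, rfl, evalPL_of_between ps fun a ha b hb => ?_, by simp⟩
        rcases hvars a ha with rfl | rfl <;> rcases hvars b hb with rfl | rfl <;>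
          first | assumption | (apply evalP_between_symm; assumption)
      · rintro ⟨f, rfl, rfl, hf, -⟩
        have h := fun a b => evalPL_between (f := f) a b ps hf
        exact ⟨_, ⟨rfl, h x x⟩, _, h x y, rfl, h y y⟩
    · simp only [Prog.psize]
      omega

/-- The case of a single distinguished variable. -/
theorem exists_icpdl_prog_self (ps : PList) (hps : PList.In Frag.icpdl ps)
    (hcard : ps.vars.toFinset.card ≤ 3)
    (hclique : ∀ x ∈ ps.vars, ∀ y ∈ ps.vars, x ≠ y → atomAdj ps [] x y)
    {x : ℕ} (hx : x ∈ ps.vars) :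
    ∃ π : Prog, Prog.In Frag.icpdl π ∧
      (∀ (K : Struct) (u v : K.World), evalP K π u v ↔ evalP K (.cq ps [] x x) u v) ∧
      π.psize ≤ 13 * (ps.plsize + 1) := by
  by_cases hy : ∃ y ∈ ps.vars, y ≠ x
  · obtain ⟨y, hy, hyx⟩ := hy
    obtain ⟨π, hπ, eπ, sπ⟩ := exists_icpdl_prog_of_ne ps hps hcard hclique hx hy hyx.symm
    refine ⟨.inter .eps (.comp π π.rev), ?_, ?_, ?_⟩
    · simp only [Prog.In]
      exact ⟨trivial, trivial, hπ, Prog.rev_in_icpdl π hπ⟩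
    · intro K u v
      simp only [evalP, evalP_rev, eπ]
      constructor
      · rintro ⟨rfl, w, ⟨f, rfl, -, hf⟩, -⟩
        exact ⟨f, rfl, rfl, hf⟩
      · rintro ⟨f, rfl, rfl, hf⟩
        exact ⟨rfl, f y, ⟨f, rfl, rfl, hf⟩, f, rfl, rfl, hf⟩
    · simp only [Prog.psize, Prog.psize_rev]
      omega
  · push Not at hy
    obtain ⟨π, hπ, sπ, eπ⟩ := ps.exists_loop_prog hps x
    refine ⟨π, hπ, fun K u v => ?_, by omega⟩
    simp only [evalP, eπ]
    constructor
    · rintro ⟨rfl, h⟩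
      refine ⟨fun _ => u, rfl, rfl, evalPL_of_between ps fun a ha b hb => ?_, by simp⟩
      rw [hy a ha, hy b hb]
      exact h
    · rintro ⟨f, rfl, rfl, hf, -⟩
      exact ⟨rfl, evalPL_between x x ps hf⟩

/-- Let `C` be a finite set of p-atoms `π(z₁,z₂)` with each `π` an
ICPDL program, such that `G_C` is a clique and `|Vars(C)| ≤ 3`.  Then for all
`x, y ∈ Vars(C)` (distinct or not) there is an ICPDL program semantically
equivalent to the conjunctive program `C[x,y]` in every structure, computable in
polynomial time (witnessed by a uniform polynomial size bound). -/
theorem statement_2 :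
    ∃ c : ℕ, ∀ ps : PList, PList.In Frag.icpdl ps →
      ps.vars.toFinset.card ≤ 3 →
      (∀ x ∈ ps.vars, ∀ y ∈ ps.vars, x ≠ y → atomAdj ps [] x y) →
      ∀ x ∈ ps.vars, ∀ y ∈ ps.vars,
        ∃ π : Prog, Prog.In Frag.icpdl π ∧
          (∀ (K : Struct) (u v : K.World), evalP K π u v ↔ evalP K (.cq ps [] x y) u v) ∧
          Prog.psize π ≤ c * (Prog.psize (.cq ps [] x y) + 1) ^ c := by
  refine ⟨13, fun ps hps hcard hclique x hx y hy => ?_⟩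
  have hsize : 13 * (ps.plsize + 1) ≤ 13 * (Prog.psize (.cq ps [] x y) + 1) ^ 13 := by
    have hcq : Prog.psize (.cq ps [] x y) = ps.plsize := by simp [Prog.psize, ratomSize]
    rw [hcq]
    exact Nat.mul_le_mul_left 13 (Nat.le_self_pow (by norm_num) _)
  by_cases hxy : x = y
  · subst hxy
    obtain ⟨π, hπ, eπ, sπ⟩ := exists_icpdl_prog_self ps hps hcard hclique hx
    exact ⟨π, hπ, eπ, sπ.trans hsize⟩
  · obtain ⟨π, hπ, eπ, sπ⟩ := exists_icpdl_prog_of_ne ps hps hcard hclique hx hy hxy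
    exact ⟨π, hπ, eπ, le_trans (by omega) hsize⟩

end PaperCPDL
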